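/- Let M be a κ-combinatorial model category (κ a regular cardinal), and let a commutative square be given with top horizontal morphism u: K → X, left vertical morphism i: K → L, right vertical morphism f: X → Y, bottom horizontal morphism v: L → Y, where i is a cofibration between κ-presentable objects and f is a weak equivalence. Then the square factors as a horizontal composite of two commutative squares through a morphism j: K′ → L′ which is a trivial cofibration between κ-presentable objects; that is, there exist morphisms K → K′, L → L′, K′ → X, L′ → Y making both squares commute and recovering u, v. -/

import Mathlib

open CategoryTheory CategoryTheory.Limits

universe w v u

namespace PaperAcc

/-- A category `J` is `κ`-filtered if every diagram indexed by a category with fewer than `κ`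
arrows admits a cocone. -/
def IsCardinalFiltered (J : Type v) [Category.{v} J] (κ : Cardinal.{v}) : Prop :=
  ∀ (A : Type v) [SmallCategory A], Cardinal.mk (Arrow A) < κ →
    ∀ F : A ⥤ J, Nonempty (Cocone F)

/-- A preorder `P` is `κ`-directed if every subset of cardinality `< κ` has an upper bound. -/
def IsCardinalDirected (P : Type v) [Preorder P] (κ : Cardinal.{v}) : Prop :=
  ∀ S : Set P, Cardinal.mk S < κ → ∃ p : P, ∀ s ∈ S, s ≤ p

/-- An object `X` is `κ`-presentable if `Hom(X, -)` preserves `κ`-filtered colimits. -/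
def IsPresentable {M : Type u} [Category.{v} M] (κ : Cardinal.{v}) (X : M) : Prop :=
  ∀ (J : Type v) [SmallCategory J], IsCardinalFiltered J κ →
    Nonempty (PreservesColimitsOfShape J (coyoneda.obj (Opposite.op X)))

/-- A presentation of `X` as a `κ`-filtered colimit of objects belonging to `P`. -/
structure FilteredColimitPresentation {M : Type u} [Category.{v} M] (κ : Cardinal.{v})
    (P : Set M) (X : M) where
  J : Type v
  [instJ : SmallCategory J]
  filtered : IsCardinalFiltered J κ
  F : J ⥤ M
  mem : ∀ j, F.obj j ∈ P
  c : Cocone F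
  isColimit : IsColimit c
  iso : c.pt ≅ X

/-- A presentation of `X` as a `κ`-directed colimit of objects belonging to `P`. -/
structure DirectedColimitPresentation {M : Type u} [Category.{v} M] (κ : Cardinal.{v})
    (P : Set M) (X : M) where
  J : Type v
  [instJ : Preorder J]
  directed : IsCardinalDirected J κ
  F : J ⥤ M
  mem : ∀ j, F.obj j ∈ P
  c : Cocone F
  isColimit : IsColimit c
  iso : c.pt ≅ X

/-- A class of arrows (viewed as a full subcategory of the arrow category) is closed under
`κ`-filtered colimits. -/
def ClosedUnderFilteredColimits {M : Type u} [Category.{v} M] (κ : Cardinal.{v})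
    (P : Set (Arrow M)) : Prop :=
  ∀ (J : Type v) [SmallCategory J], IsCardinalFiltered J κ →
    ∀ (F : J ⥤ Arrow M) (c : Cocone F), IsColimit c → (∀ j, F.obj j ∈ P) → c.pt ∈ P

/-- The morphisms having the right lifting property with respect to every member of the
family `f`. -/
def RlpOf {M : Type u} [Category.{v} M] {ι : Type w} {A B : ι → M}
    (f : ∀ i, A i ⟶ B i) : MorphismProperty M :=
  fun _ _ g => ∀ i, HasLiftingProperty (f i) g

/-- The morphisms having the left lifting property with respect to every morphism in `P`. -/
def Llp {M : Type u} [Category.{v} M] (P : MorphismProperty M) : MorphismProperty M :=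
  fun _ _ g => ∀ ⦃X Y : M⦄ (p : X ⟶ Y), P p → HasLiftingProperty g p

/-- The class `C` is cofibrantly generated by a set of morphisms between `κ`-presentable
objects: `C = llp(rlp(I))` for such a set `I`. -/
def CofibrantlyGeneratedByPresentables {M : Type u} [Category.{v} M] (κ : Cardinal.{v})
    (C : MorphismProperty M) : Prop :=
  ∃ (ι : Type v) (A B : ι → M) (f : ∀ i, A i ⟶ B i),
    (∀ i, IsPresentable κ (A i)) ∧ (∀ i, IsPresentable κ (B i)) ∧
      C = Llp (RlpOf f)

/-- A category is locally `κ`-presentable: it is cocomplete and has a set of `κ`-presentable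
objects such that every object is a `κ`-filtered colimit of objects from this set. -/
def IsLocallyPresentable (M : Type u) [Category.{v} M] (κ : Cardinal.{v}) : Prop :=
  HasColimits M ∧
    ∃ (ι : Type v) (G : ι → M), (∀ i, IsPresentable κ (G i)) ∧
      ∀ X : M, Nonempty (FilteredColimitPresentation κ (Set.range G) X)

/-- A class of morphisms is stable under retracts (in the arrow category). -/
def IsStableUnderRetracts {M : Type u} [Category.{v} M] (P : MorphismProperty M) : Prop :=
  ∀ {X Y X' Y' : M} (f : X ⟶ Y) (g : X' ⟶ Y') (iX : X ⟶ X') (rX : X' ⟶ X)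
    (iY : Y ⟶ Y') (rY : Y' ⟶ Y), iX ≫ rX = 𝟙 X → iY ≫ rY = 𝟙 Y →
    iX ≫ g = f ≫ iY → rX ≫ f = g ≫ rY → P g → P f

/-- A model structure on a category: classes of weak equivalences, cofibrations and fibrations
satisfying the axioms of a (closed) model category. -/
structure ModelStructure (M : Type u) [Category.{v} M] where
  W : MorphismProperty M
  Cof : MorphismProperty M
  Fib : MorphismProperty M
  W_id : ∀ X : M, W (𝟙 X)
  W_comp : ∀ {X Y Z : M} (f : X ⟶ Y) (g : Y ⟶ Z), W f → W g → W (f ≫ g)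
  W_of_comp_right : ∀ {X Y Z : M} (f : X ⟶ Y) (g : Y ⟶ Z), W g → W (f ≫ g) → W f
  W_of_comp_left : ∀ {X Y Z : M} (f : X ⟶ Y) (g : Y ⟶ Z), W f → W (f ≫ g) → W g
  W_retract : IsStableUnderRetracts W
  Cof_retract : IsStableUnderRetracts Cof
  Fib_retract : IsStableUnderRetracts Fib
  lift_trivCof_fib : ∀ {A B X Y : M} (i : A ⟶ B) (p : X ⟶ Y),
    Cof i → W i → Fib p → HasLiftingProperty i p
  lift_cof_trivFib : ∀ {A B X Y : M} (i : A ⟶ B) (p : X ⟶ Y),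
    Cof i → Fib p → W p → HasLiftingProperty i p
  fact_cof_trivFib : ∀ {X Y : M} (f : X ⟶ Y),
    ∃ (Z : M) (i : X ⟶ Z) (p : Z ⟶ Y), Cof i ∧ Fib p ∧ W p ∧ i ≫ p = f
  fact_trivCof_fib : ∀ {X Y : M} (f : X ⟶ Y),
    ∃ (Z : M) (i : X ⟶ Z) (p : Z ⟶ Y), Cof i ∧ W i ∧ Fib p ∧ i ≫ p = f

/-- A model structure is `κ`-combinatorial if the underlying category is locally
`κ`-presentable and both cofibrations and trivial cofibrations are cofibrantly generated
by sets of morphisms between `κ`-presentable objects. -/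
structure IsCombinatorial {M : Type u} [Category.{v} M] (S : ModelStructure M)
    (κ : Cardinal.{v}) : Prop where
  isRegular : κ.IsRegular
  locallyPresentable : IsLocallyPresentable M κ
  cofGenerated : CofibrantlyGeneratedByPresentables κ S.Cof
  trivCofGenerated : CofibrantlyGeneratedByPresentables κ (S.Cof ⊓ S.W)

/-- An object is cofibrant if the morphism from an(y) initial object to it is a cofibration. -/
def Cofibrant {M : Type u} [Category.{v} M] (S : ModelStructure M) (X : M) : Prop :=
  ∀ ⦃O : M⦄, IsInitial O → ∀ f : O ⟶ X, S.Cof f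

/-- A cylinder object for `X`: a factorization `X ⊔ X → C → X` of the codiagonal into
a cofibration followed by a weak equivalence. -/
structure CylinderObject {M : Type u} [Category.{v} M] (S : ModelStructure M) (X : M) where
  C : M
  i₀ : X ⟶ C
  i₁ : X ⟶ C
  p : C ⟶ X
  hi₀ : i₀ ≫ p = 𝟙 X
  hi₁ : i₁ ≫ p = 𝟙 X
  hp : S.W p
  hcof : ∀ (c : BinaryCofan X X) (hc : IsColimit c), S.Cof (hc.desc (BinaryCofan.mk i₀ i₁))

/-- A commutative square on `(f, g, h, k)` (with `f : A ⟶ B`, `g : A ⟶ X`, `h : B ⟶ Y`,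
`k : X ⟶ Y`) is a homotopy pushout: for some (equivalently, any) replacement of the span
`B ← A → X` by a span of cofibrations between cofibrant objects which is weakly equivalent
to it, the comparison morphism from the (strict) pushout of the replacement to `Y` is a
weak equivalence. -/
def IsHomotopyPushout {M : Type u} [Category.{v} M] (S : ModelStructure M)
    {A B X Y : M} (f : A ⟶ B) (g : A ⟶ X) (h : B ⟶ Y) (k : X ⟶ Y) : Prop :=
  ∃ (A' B' X' P : M) (wA : A' ⟶ A) (i : A' ⟶ B') (wB : B' ⟶ B)
    (j : A' ⟶ X') (wX : X' ⟶ X) (pB : B' ⟶ P) (pX : X' ⟶ P) (m : P ⟶ Y),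
      Cofibrant S A' ∧ S.W wA ∧ S.Cof i ∧ S.W wB ∧ S.Cof j ∧ S.W wX ∧
      i ≫ wB = wA ≫ f ∧ j ≫ wX = wA ≫ g ∧
      IsPushout i j pB pX ∧ pB ≫ m = wB ≫ h ∧ pX ≫ m = wX ≫ k ∧ S.W m

/-- A morphism `i : A ⟶ B` is a formal cofibration if every pushout square of `i` along a
morphism `f : A ⟶ X` with `X` cofibrant is a homotopy pushout. -/
def IsFormalCofibration {M : Type u} [Category.{v} M] (S : ModelStructure M)
    {A B : M} (i : A ⟶ B) : Prop :=
  ∀ {X Y : M} (f : A ⟶ X) (g : B ⟶ Y) (k : X ⟶ Y),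
    Cofibrant S X → IsPushout i f g k → IsHomotopyPushout S i f g k

/-- The set of arrows satisfying `P` whose domain and codomain are `κ`-presentable. -/
def PresentableArrowsIn {M : Type u} [Category.{v} M] (κ : Cardinal.{v})
    (P : Set (Arrow M)) : Set (Arrow M) :=
  {a | a ∈ P ∧ IsPresentable κ a.left ∧ IsPresentable κ a.right}

end PaperAcc

namespace CombinatorialModel

variable {C : Type u} [Category.{v} C] {κ : Cardinal.{v}} [Fact κ.IsRegular]

lemma hasCardinalLT_arrow_of_finCategory (I : Type) [SmallCategory I] [FinCategory I]
    (κ : Cardinal.{v}) [Fact κ.IsRegular] : HasCardinalLT (Arrow I) κ := by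
  refine .of_le ?_ (Cardinal.IsRegular.aleph0_le (c := κ) Fact.out)
  simp only [hasCardinalLT_aleph0_iff]
  infer_instance

/-- Every diagram `I ⥤ C` of finite shape in a locally `κ`-presentable category is
a `κ`-filtered colimit of diagrams with `κ`-presentable values. -/
lemma exists_pointwise_presentation [IsCardinalLocallyPresentable C κ]
    {I : Type} [SmallCategory I] [FinCategory I] (G : I ⥤ C) :
    ∃ (D : Type v) (_ : SmallCategory D) (_ : IsCardinalFiltered D κ)
      (p : ColimitPresentation D G),
      ∀ d i, IsCardinalPresentable ((p.diag.obj d).obj i) κ := by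
  have := fun a b : I ↦ hasFiniteCoproducts_of_hasFiniteColimits C |>.out
  obtain ⟨P, _, hP⟩ := HasCardinalFilteredGenerator.exists_small_generator C κ
  let L (x : I × Subtype P) := (evaluationLeftAdjoint C x.1).obj x.2.1
  let R : ObjectProperty (I ⥤ C) := ObjectProperty.ofObj L
  have hG₀ (i : Subtype P) : IsCardinalPresentable i.1 κ := hP.le_isCardinalPresentable _ i.2
  have hR : R.IsStrongGenerator := by
    rw [ObjectProperty.isStrongGenerator_iff]
    refine ⟨fun X Y f g h ↦ ?_, fun X Y f _ h ↦ ?_⟩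
    · ext i
      refine hP.isStrongGenerator.isSeparating _ _ fun A hA a ↦ ?_
      have := h (L ⟨i, A, hA⟩) (ObjectProperty.ofObj_apply _ _)
        (((evaluationAdjunctionRight C i).homEquiv _ _).symm a)
      have h2 := congrArg ((evaluationAdjunctionRight C i).homEquiv _ _) this
      rw [Adjunction.homEquiv_naturality_right, Adjunction.homEquiv_naturality_right] at h2
      simpa using h2
    · rw [NatTrans.isIso_iff_isIso_app]
      intro i
      have : Mono (f.app i) := inferInstanceAs (Mono (((evaluation _ _).obj i).map f))
      refine hP.isStrongGenerator.isIso_of_mono _ fun A hA a ↦ ?_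
      obtain ⟨b, hb⟩ := h (L ⟨i, A, hA⟩) (ObjectProperty.ofObj_apply _ _)
        (((evaluationAdjunctionRight C i).homEquiv _ _).symm a)
      refine ⟨(evaluationAdjunctionRight C i).homEquiv _ _ b, ?_⟩
      have h2 := congrArg ((evaluationAdjunctionRight C i).homEquiv _ _) hb
      dsimp only at h2
      rw [Adjunction.homEquiv_naturality_right] at h2
      simpa using h2
  have hR' : R ≤ isCardinalPresentable (I ⥤ C) κ := by
    rintro _ ⟨⟨i, A⟩⟩
    have : ((evaluation I C).obj i).IsCardinalAccessible κ := ⟨fun J _ _ ↦ inferInstance⟩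
    exact (evaluationAdjunctionRight C i).isCardinalPresentable_leftAdjoint_obj κ A.1
  have : ObjectProperty.Small.{v} R := inferInstance
  have := ObjectProperty.IsStrongGenerator.isDense_colimitsCardinalClosure_ι.{v} (κ := κ) hR hR'
  have : ObjectProperty.EssentiallySmall.{v} (R.colimitsCardinalClosure κ) := inferInstance
  have : LocallySmall.{v} (I ⥤ C) := inferInstance
  have h₁ : R.colimitsCardinalClosure κ ≤ isCardinalPresentable (I ⥤ C) κ :=
    ObjectProperty.colimitsCardinalClosure_le_isCardinalPresentable.{v} R hR'
  have (X : I ⥤ C) : IsCardinalFiltered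
      (CostructuredArrow (R.colimitsCardinalClosure κ).ι X) κ := inferInstance
  have hG : (R.colimitsCardinalClosure κ).IsCardinalFilteredGenerator κ :=
    IsCardinalFilteredGenerator.of_isDense_ι.{v} (R.colimitsCardinalClosure κ) κ h₁
  obtain ⟨D, _, _, ⟨p⟩⟩ := hG.exists_colimitsOfShape G
  refine ⟨D, inferInstance, inferInstance, p.toColimitPresentation, fun d i ↦ ?_⟩
  have key : R.colimitsCardinalClosure κ ≤
      (isCardinalPresentable C κ).inverseImage ((evaluation I C).obj i) := by
    refine R.colimitsCardinalClosure_le κ (fun J _ hJ ↦ ⟨?_⟩) ?_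
    · rintro X ⟨q⟩
      have := isClosedUnderColimitsOfShape_isCardinalPresentable C hJ
      exact ObjectProperty.prop_of_isColimit (P := isCardinalPresentable C κ)
        (isColimitOfPreserves ((evaluation I C).obj i) q.isColimit)
        q.prop_diag_obj
    · rintro _ ⟨⟨k, A⟩⟩
      have : (isCardinalPresentable C κ).IsClosedUnderColimitsOfShape (Discrete (k ⟶ i)) :=
        isClosedUnderColimitsOfShape_isCardinalPresentable C
          (hasCardinalLT_arrow_of_finCategory _ κ)
      exact ObjectProperty.prop_colimit (P := isCardinalPresentable C κ) _ fun _ ↦ hG₀ A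
  exact key _ (p.prop_diag_obj d)

/-- A morphism with `κ`-presentable source and target, mapping to a `κ`-filtered colimit of
morphisms, factors through one of these morphisms. -/
lemma exists_fac_of_isColimit {D : Type*} [Category* D] [EssentiallySmall.{v} D]
    [IsCardinalFiltered D κ] {F G : D ⥤ C} (β : F ⟶ G) {c : Cocone F} {d : Cocone G}
    (hc : IsColimit c) (hd : IsColimit d) {g : c.pt ⟶ d.pt}
    (hg : ∀ x, c.ι.app x ≫ g = β.app x ≫ d.ι.app x)
    {K L : C} [IsCardinalPresentable K κ] [IsCardinalPresentable L κ] (i : K ⟶ L)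
    (u : K ⟶ c.pt) (v : L ⟶ d.pt) (h : u ≫ g = i ≫ v) :
    ∃ (x : D) (u' : K ⟶ F.obj x) (v' : L ⟶ G.obj x),
      u' ≫ β.app x = i ≫ v' ∧ u' ≫ c.ι.app x = u ∧ v' ≫ d.ι.app x = v := by
  obtain ⟨x, u', rfl⟩ := IsCardinalPresentable.exists_hom_of_isColimit κ hc u
  obtain ⟨y, v', rfl⟩ := IsCardinalPresentable.exists_hom_of_isColimit κ hd v
  obtain ⟨z, a, b, hz⟩ := IsCardinalPresentable.exists_eq_of_isColimit κ hd
    (u' ≫ β.app x) (i ≫ v') (by simpa [hg] using h)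
  exact ⟨z, u' ≫ F.map a, v' ≫ G.map b, by simpa using hz, by simp, by simp⟩

/-- Every span in a locally `κ`-presentable category is a `κ`-filtered colimit of spans of
`κ`-presentable objects. -/
lemma exists_span_presentation [IsCardinalLocallyPresentable C κ] {X Y Z : C}
    (f : X ⟶ Y) (g : X ⟶ Z) :
    ∃ (D : Type v) (_ : SmallCategory D) (_ : IsCardinalFiltered D κ)
      (pX : ColimitPresentation D X) (pY : ColimitPresentation D Y)
      (pZ : ColimitPresentation D Z) (α : pX.diag ⟶ pY.diag) (β : pX.diag ⟶ pZ.diag),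
      (∀ d, pX.ι.app d ≫ f = α.app d ≫ pY.ι.app d) ∧
      (∀ d, pX.ι.app d ≫ g = β.app d ≫ pZ.ι.app d) ∧
      (∀ d, IsCardinalPresentable (pX.diag.obj d) κ) ∧
      (∀ d, IsCardinalPresentable (pY.diag.obj d) κ) ∧
      ∀ d, IsCardinalPresentable (pZ.diag.obj d) κ := by
  obtain ⟨D, _, _, p, hp⟩ := exists_pointwise_presentation (κ := κ) (span f g)
  refine ⟨D, inferInstance, inferInstance, p.map ((evaluation _ _).obj .zero),
    p.map ((evaluation _ _).obj .left), p.map ((evaluation _ _).obj .right),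
    Functor.whiskerLeft p.diag ((evaluation _ _).map WalkingSpan.Hom.fst),
    Functor.whiskerLeft p.diag ((evaluation _ _).map WalkingSpan.Hom.snd),
    fun d ↦ ?_, fun d ↦ ?_, fun d ↦ hp _ _, fun d ↦ hp _ _, fun d ↦ hp _ _⟩
  · have h := ((p.ι.app d).naturality WalkingSpan.Hom.fst).symm
    simp only [ColimitPresentation.map, NatTrans.comp_app]
    erw [Category.comp_id, Category.comp_id]
    exact h
  · have h := ((p.ι.app d).naturality WalkingSpan.Hom.snd).symm
    simp only [ColimitPresentation.map, NatTrans.comp_app]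
    erw [Category.comp_id, Category.comp_id]
    exact h

variable (κ) in
/-- The morphisms `g` such that every commutative square from a morphism between `κ`-presentable
objects to `g` factors through a morphism in `T` between `κ`-presentable objects. -/
def factorsThroughPresentables (T : MorphismProperty C) : MorphismProperty C :=
  fun X Y g ↦ ∀ ⦃K L : C⦄ (i : K ⟶ L) (u : K ⟶ X) (v : L ⟶ Y),
    IsCardinalPresentable K κ → IsCardinalPresentable L κ → u ≫ g = i ≫ v →
    ∃ (K' L' : C) (a : K ⟶ K') (b : L ⟶ L') (j : K' ⟶ L') (u' : K' ⟶ X) (v' : L' ⟶ Y),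
      IsCardinalPresentable K' κ ∧ IsCardinalPresentable L' κ ∧ T j ∧
      a ≫ j = i ≫ b ∧ u' ≫ g = j ≫ v' ∧ a ≫ u' = u ∧ b ≫ v' = v

namespace factorsThroughPresentables

variable (T : MorphismProperty C)

instance isStableUnderColimitsOfShape (D : Type*) [Category* D] [EssentiallySmall.{v} D]
    [IsCardinalFiltered D κ] :
    (factorsThroughPresentables κ T).IsStableUnderColimitsOfShape D where
  condition F G c d hc hd β hβ g hg := by
    intro K L i u v _ _ h
    obtain ⟨x, u', v', h', rfl, rfl⟩ := exists_fac_of_isColimit (κ := κ) β hc hd hg i u v h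
    obtain ⟨K', L', a, b, j, u'', v'', hK', hL', hj, h₁, h₂, rfl, rfl⟩ :=
      hβ x i u' v' inferInstance inferInstance h'
    exact ⟨K', L', a, b, j, u'' ≫ c.ι.app x, v'' ≫ d.ι.app x, hK', hL', hj, h₁,
      by simp [hg, reassoc_of% h₂], by simp, by simp⟩

instance isStableUnderRetracts : (factorsThroughPresentables κ T).IsStableUnderRetracts where
  of_retract {X Y Z W f g} r hg := by
    intro K L i u v hK hL h
    obtain ⟨K', L', a, b, j, u', v', hK', hL', hj, h₁, h₂, h₃, h₄⟩ :=
      hg i (u ≫ r.i.left) (v ≫ r.i.right) hK hL (by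
        have := r.i.w
        dsimp at this
        simp [this, reassoc_of% h])
    refine ⟨K', L', a, b, j, u' ≫ r.r.left, v' ≫ r.r.right, hK', hL', hj, h₁, ?_, ?_, ?_⟩
    · have := r.r.w
      dsimp at this
      simp [this, reassoc_of% h₂]
    · simp [reassoc_of% h₃]
    · simp [reassoc_of% h₄]

instance containsIdentities [T.ContainsIdentities] :
    (factorsThroughPresentables κ T).ContainsIdentities where
  id_mem X K L i u v hK hL h :=
    ⟨L, L, i, 𝟙 L, 𝟙 L, v, v, hL, hL, T.id_mem L, by simp, by simp, by simpa using h.symm, by simp⟩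

lemma isCardinalPresentable_pushout [HasPushouts C] {X Y Z : C} (f : X ⟶ Y) (g : X ⟶ Z)
    (hX : IsCardinalPresentable X κ) (hY : IsCardinalPresentable Y κ)
    (hZ : IsCardinalPresentable Z κ) : IsCardinalPresentable (pushout f g) κ := by
  have (k : WalkingSpan) : IsCardinalPresentable ((span f g).obj k) κ := by
    rcases k with _ | _ | _ <;> assumption
  exact isCardinalPresentable_of_isColimit _ (colimit.isColimit (span f g)) κ
    (hasCardinalLT_arrow_of_finCategory _ κ)

instance isStableUnderComposition [HasPushouts C] [T.IsStableUnderComposition]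
    [T.IsStableUnderCobaseChange] :
    (factorsThroughPresentables κ T).IsStableUnderComposition where
  comp_mem {X Y Z} f g hf hg := by
    intro K L i u v hK hL h
    obtain ⟨K₁, L₁, a, b, j, u₁, v₁, hK₁, hL₁, hj, h₁, h₂, h₃, rfl⟩ :=
      hg i (u ≫ f) v hK hL (by simpa using h)
    obtain ⟨K₂, L₂, a', b', j', u₂, v₂, hK₂, hL₂, hj', h₁', h₂', rfl, rfl⟩ :=
      hf a u u₁ hK hK₁ h₃.symm
    refine ⟨K₂, pushout b' j, a', b ≫ pushout.inr _ _, j' ≫ pushout.inl _ _, u₂,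
      pushout.desc (v₂ ≫ g) v₁ (by simpa using h₂), hK₂,
      isCardinalPresentable_pushout _ _ hK₁ hL₂ hL₁,
      T.comp_mem _ _ hj' (T.pushout_inl _ _ hj), ?_, ?_, rfl, ?_⟩
    · simp only [reassoc_of% h₁', ← reassoc_of% h₁, pushout.condition]
    · rw [Category.assoc, pushout.inl_desc, reassoc_of% h₂']
    · rw [Category.assoc, pushout.inr_desc]

end factorsThroughPresentables

variable {J : MorphismProperty C}

lemma isCardinalForSmallObjectArgument [IsCardinalLocallyPresentable C κ]
    [MorphismProperty.IsSmall.{v} J] [OrderBot κ.ord.ToType]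
    (hJ : ∀ ⦃A B : C⦄ (j : A ⟶ B), J j → IsCardinalPresentable A κ) :
    J.IsCardinalForSmallObjectArgument κ where
  hasIterationOfShape := { }
  preservesColimit {A B X Y} j hj f hf := by
    have := hJ j hj
    have := preservesColimitsOfShape_of_isCardinalPresentable A κ κ.ord.ToType
    infer_instance

/-- Morphisms with the right lifting property against morphisms between `κ`-presentable objects
are stable under `κ`-filtered colimits. -/
lemma isStableUnderColimitsOfShape_rlp (hJ : ∀ ⦃A B : C⦄ (j : A ⟶ B), J j →
      IsCardinalPresentable A κ ∧ IsCardinalPresentable B κ)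
    (D : Type v) [SmallCategory D] [IsCardinalFiltered D κ] :
    J.rlp.IsStableUnderColimitsOfShape D where
  condition F G c d hc hd β hβ g hg A B j hj := by
    obtain ⟨_, _⟩ := hJ j hj
    refine ⟨fun {u v} sq ↦ ?_⟩
    obtain ⟨x, u', v', h', rfl, rfl⟩ := exists_fac_of_isColimit (κ := κ) β hc hd hg j u v sq.w
    have := hβ x j hj
    have sq' : CommSq u' j (β.app x) v' := ⟨h'⟩
    exact ⟨⟨⟨sq'.lift ≫ c.ι.app x, by simp, by simp [hg]⟩⟩⟩

/-- A lift of `cG.ι.app d ≫ s` to a member of the diagram `E`, where `s` is a section of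
the colimit of `p : E ⟶ G`. -/
structure PartialSection {D : Type v} [SmallCategory D] {F E G : D ⥤ C}
    (e : F ⟶ E) (p : E ⟶ G) {cE : Cocone E} {cG : Cocone G} (s : cG.pt ⟶ cE.pt) (d : D) where
  target : D
  hom : d ⟶ target
  lift : G.obj d ⟶ E.obj target
  lift_p : lift ≫ p.app target = G.map hom
  e_lift : e.app d ≫ p.app d ≫ lift = F.map hom ≫ e.app target
  lift_ι : lift ≫ cE.ι.app target = cG.ι.app d ≫ s

section

variable {D : Type v} [SmallCategory D] [IsCardinalFiltered D κ] {F E G : D ⥤ C}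
  (e : F ⟶ E) (p : E ⟶ G) {cE : Cocone E} {cG : Cocone G} (hE : IsColimit cE) (hG : IsColimit cG)
  (q : cE.pt ⟶ cG.pt) (hq : ∀ d, cE.ι.app d ≫ q = p.app d ≫ cG.ι.app d)
  (s : cG.pt ⟶ cE.pt) (hs : s ≫ q = 𝟙 _)
  (hs' : ∀ d, e.app d ≫ p.app d ≫ cG.ι.app d ≫ s = e.app d ≫ cE.ι.app d)
  [∀ d, IsCardinalPresentable (F.obj d) κ] [∀ d, IsCardinalPresentable (G.obj d) κ]

include κ hE hG hq hs hs'

variable (κ) in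
lemma PartialSection.nonempty (d : D) : Nonempty (PartialSection e p s d) := by
  have := isFiltered_of_isCardinalFiltered D κ
  obtain ⟨x, t, ht⟩ := IsCardinalPresentable.exists_hom_of_isColimit κ hE (cG.ι.app d ≫ s)
  obtain ⟨x₁, a, b, h₁⟩ := IsCardinalPresentable.exists_eq_of_isColimit κ hG (t ≫ p.app x)
    (𝟙 (G.obj d)) (by simp [← hq, reassoc_of% ht, hs])
  obtain ⟨x₂, b', a', h₂⟩ := IsCardinalPresentable.exists_eq_of_isColimit κ hE
    (F.map b ≫ e.app x₁) (e.app d ≫ p.app d ≫ t ≫ E.map a)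
    (by simp [ht, hs'])
  obtain ⟨x₃, c, hc⟩ : ∃ (x₃ : D) (c : x₂ ⟶ x₃), b' ≫ c = a' ≫ c :=
    ⟨_, _, IsFiltered.coeq_condition b' a'⟩
  refine ⟨⟨x₃, b ≫ a' ≫ c, t ≫ E.map (a ≫ a' ≫ c), ?_, ?_, ?_⟩⟩
  · simp [reassoc_of% h₁]
  · have := h₂ =≫ E.map c
    simp only [Category.assoc, ← Functor.map_comp, hc] at this
    simpa using this.symm
  · simp [ht]

variable (κ) in
lemma PartialSection.exists_next {d : D} (σ : PartialSection e p s d) :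
    ∃ τ : PartialSection e p s σ.target, G.map σ.hom ≫ τ.lift = σ.lift ≫ E.map τ.hom := by
  obtain ⟨x, φ, t, h₁, h₂, h₃⟩ := nonempty κ e p hE hG q hq s hs hs' σ.target
  obtain ⟨y, ψ, hψ⟩ := IsCardinalPresentable.exists_eq_of_isColimit' κ hE
    (G.map σ.hom ≫ t) (σ.lift ≫ E.map φ) (by simp [h₃, σ.lift_ι])
  refine ⟨⟨y, φ ≫ ψ, t ≫ E.map ψ, ?_, ?_, ?_⟩, ?_⟩
  · simp [reassoc_of% h₁]
  · simp [reassoc_of% h₂]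
  · simp [h₃]
  · simpa using hψ

variable (κ) in
/-- Partial sections may be chosen compatibly along a sequence in the index category. -/
lemma exists_sequence_of_section (d : D) :
    ∃ (N : ℕ ⥤ D) (_ : N.obj 0 = d) (t : ∀ n, G.obj (N.obj n) ⟶ E.obj (N.obj (n + 1))),
      (∀ n, t n ≫ p.app _ = G.map (N.map (homOfLE (Nat.le_add_right n 1)))) ∧
      (∀ n, e.app _ ≫ p.app _ ≫ t n =
        F.map (N.map (homOfLE (Nat.le_add_right n 1))) ≫ e.app _) ∧
      ∀ n, G.map (N.map (homOfLE (Nat.le_add_right n 1))) ≫ t (n + 1) =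
        t n ≫ E.map (N.map (homOfLE (Nat.le_add_right (n + 1) 1))) := by
  obtain ⟨σ₀⟩ := PartialSection.nonempty κ e p hE hG q hq s hs hs' d
  choose next hnext using fun (σ : Σ d, PartialSection e p s d) ↦
    PartialSection.exists_next κ e p hE hG q hq s hs hs' σ.2
  let σ (n : ℕ) : Σ d, PartialSection e p s d :=
    Nat.rec ⟨d, σ₀⟩ (fun _ σ ↦ ⟨σ.2.target, next σ⟩) n
  let f (n : ℕ) : (σ n).1 ⟶ (σ (n + 1)).1 := (σ n).2.hom
  refine ⟨Functor.ofSequence f, rfl, fun n ↦ (σ n).2.lift, fun n ↦ ?_, fun n ↦ ?_, fun n ↦ ?_⟩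
  · rw [Functor.ofSequence_map_homOfLE_succ]
    exact (σ n).2.lift_p
  · rw [Functor.ofSequence_map_homOfLE_succ]
    exact (σ n).2.e_lift
  · rw [Functor.ofSequence_map_homOfLE_succ, Functor.ofSequence_map_homOfLE_succ]
    exact hnext (σ n)

end

lemma rlp_llp_le_factorsThroughPresentables_of_aleph0_lt [IsCardinalLocallyPresentable C κ]
    (hκ : Cardinal.aleph0 < κ) [MorphismProperty.IsSmall.{v} J]
    (hJ : ∀ ⦃A B : C⦄ (j : A ⟶ B), J j → IsCardinalPresentable A κ ∧ IsCardinalPresentable B κ) :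
    J.rlp.llp ≤ factorsThroughPresentables κ J.rlp.llp := by
  intro X Z g hg K L i u v _ _ huv
  have : Nonempty κ.ord.ToType := by
    simpa using (Cardinal.IsRegular.pos (c := κ) Fact.out).ne'
  let : OrderBot κ.ord.ToType := WellFoundedLT.toOrderBot _
  have := isCardinalForSmallObjectArgument (κ := κ) (J := J) (fun _ _ j hj ↦ (hJ j hj).1)
  have : MorphismProperty.HasSmallObjectArgument.{v} J := ⟨κ, inferInstance, inferInstance, this⟩
  let fac := MorphismProperty.functorialFactorizationData J.rlp.llp J.rlp
  obtain ⟨D, _, _, pX, pZ, _, β, -, hβ, -, hX, hZ, -⟩ := exists_span_presentation (κ := κ) g g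
  let A : D ⥤ Arrow C :=
    { obj d := Arrow.mk (β.app d)
      map f := Arrow.homMk (pX.diag.map f) (pZ.diag.map f) }
  let E : D ⥤ C := A ⋙ fac.Z
  let e : pX.diag ⟶ E := Functor.whiskerLeft A fac.i
  let p : E ⟶ pZ.diag := Functor.whiskerLeft A fac.p
  have hep (d : D) : e.app d ≫ p.app d = β.app d := fac.fac_app
  let q : colimit E ⟶ Z := colimit.desc E (Cocone.mk Z (p ≫ pZ.ι))
  have hq (d : D) : colimit.ι E d ≫ q = p.app d ≫ pZ.ι.app d := by simp [q]
  have hqJ : J.rlp q := (isStableUnderColimitsOfShape_rlp hJ D).condition _ _ _ _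
    (colimit.isColimit E) pZ.isColimit p (fun d ↦ fac.hp _) q hq
  let r : X ⟶ colimit E := pX.isColimit.desc (Cocone.mk _ (e ≫ (colimit.cocone E).ι))
  have hr (d : D) : pX.ι.app d ≫ r = e.app d ≫ colimit.ι E d :=
    pX.isColimit.fac (Cocone.mk _ (e ≫ (colimit.cocone E).ι)) d
  have sq : CommSq r g q (𝟙 Z) := ⟨pX.isColimit.hom_ext fun d ↦ by
    simp [reassoc_of% hr, hq, hβ, reassoc_of% hep]⟩
  have := hg q hqJ
  obtain ⟨x, u', v', h', rfl, rfl⟩ :=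
    exists_fac_of_isColimit (κ := κ) β pX.isColimit pZ.isColimit hβ i u v huv
  obtain ⟨N, rfl, t, ht₁, ht₂, ht₃⟩ := exists_sequence_of_section κ e p (colimit.isColimit E)
    pZ.isColimit q hq sq.lift (by simp) (fun d ↦ by
      dsimp
      rw [reassoc_of% hep, ← reassoc_of% hβ, sq.fac_left, hr]) x
  have hℕ : HasCardinalLT (Arrow ℕ) κ := by
    have : Countable (Arrow ℕ) :=
      Function.Injective.countable (f := fun a : Arrow ℕ ↦ (a.left, a.right)) (by
        rintro ⟨a, b, f⟩ ⟨a', b', f'⟩ h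
        obtain ⟨rfl, rfl⟩ := Prod.mk.inj h
        obtain rfl : f = f' := Subsingleton.elim _ _
        rfl)
    exact (Cardinal.lift_le_aleph0.2 (Cardinal.mk_le_aleph0 (α := Arrow ℕ))).trans_lt
      (Cardinal.aleph0_lt_lift.2 hκ)
  let g' : colimit (N ⋙ pX.diag) ⟶ colimit (N ⋙ pZ.diag) := colimMap (Functor.whiskerLeft N β)
  let c (n : ℕ) : A.obj (N.obj n) ⟶ Arrow.mk g' :=
    Arrow.homMk (colimit.ι (N ⋙ pX.diag) n) (colimit.ι (N ⋙ pZ.diag) n) (by simp [g', A])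
  have hc {m n : ℕ} (f : m ⟶ n) : A.map (N.map f) ≫ c n = c m := by
    ext
    · exact colimit.w (N ⋙ pX.diag) f
    · exact colimit.w (N ⋙ pZ.diag) f
  let σ : colimit (N ⋙ pZ.diag) ⟶ fac.Z.obj (Arrow.mk g') :=
    colimit.desc (N ⋙ pZ.diag) (Cocone.mk _ (NatTrans.ofSequence
      (fun n ↦ t n ≫ fac.Z.map (c (n + 1))) (fun n ↦ by
        have := ht₃ n =≫ fac.Z.map (c (n + 2))
        simp only [Category.assoc, E, Functor.comp_map, ← Functor.map_comp, hc] at this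
        simpa using this)))
  have hσ (n : ℕ) : colimit.ι (N ⋙ pZ.diag) n ≫ σ = t n ≫ fac.Z.map (c (n + 1)) := by
    simp [σ]
  let e' : colimit (N ⋙ pX.diag) ⟶ fac.Z.obj (Arrow.mk g') := fac.i.app (Arrow.mk g')
  let p' : fac.Z.obj (Arrow.mk g') ⟶ colimit (N ⋙ pZ.diag) := fac.p.app (Arrow.mk g')
  have he' (n : ℕ) : colimit.ι (N ⋙ pX.diag) n ≫ e' = e.app (N.obj n) ≫ fac.Z.map (c n) :=
    fac.i.naturality (c n)
  have hp' (n : ℕ) : fac.Z.map (c n) ≫ p' = p.app (N.obj n) ≫ colimit.ι (N ⋙ pZ.diag) n :=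
    fac.p.naturality (c n)
  have he'p' : e' ≫ p' = g' := fac.fac_app
  have hg'σ : g' ≫ σ = e' := by
    refine colimit.hom_ext fun n ↦ ?_
    rw [ι_colimMap_assoc, hσ, Functor.whiskerLeft_app, ← hep, Category.assoc,
      reassoc_of% (ht₂ n), ← he', ← colimit.w (N ⋙ pX.diag) (homOfLE (Nat.le_add_right n 1)),
      Category.assoc]
    rfl
  have hσp' : σ ≫ p' = 𝟙 _ := by
    refine colimit.hom_ext fun n ↦ ?_
    rw [reassoc_of% hσ, hp', reassoc_of% (ht₁ n), Category.comp_id]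
    exact colimit.w (N ⋙ pZ.diag) (homOfLE (Nat.le_add_right n 1))
  have hg' : J.rlp.llp g' := by
    intro V W y hy
    have : HasLiftingProperty e' y := fac.hi (Arrow.mk g') y hy
    refine ⟨fun {k l} sq ↦ ?_⟩
    have sq' : CommSq k e' y (p' ≫ l) := ⟨by rw [reassoc_of% he'p', sq.w]⟩
    exact ⟨⟨⟨σ ≫ sq'.lift, by rw [reassoc_of% hg'σ, sq'.fac_left],
      by rw [Category.assoc, sq'.fac_right, reassoc_of% hσp']⟩⟩⟩
  refine ⟨_, _, u' ≫ colimit.ι (N ⋙ pX.diag) 0, v' ≫ colimit.ι (N ⋙ pZ.diag) 0, g',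
    colimit.desc (N ⋙ pX.diag) (Cocone.mk _ (Functor.whiskerLeft N pX.ι)),
    colimit.desc (N ⋙ pZ.diag) (Cocone.mk _ (Functor.whiskerLeft N pZ.ι)), ?_, ?_, hg',
    ?_, ?_, ?_, ?_⟩
  · have (n : ℕ) : IsCardinalPresentable ((N ⋙ pX.diag).obj n) κ := hX _
    exact isCardinalPresentable_of_isColimit _ (colimit.isColimit (N ⋙ pX.diag)) κ hℕ
  · have (n : ℕ) : IsCardinalPresentable ((N ⋙ pZ.diag).obj n) κ := hZ _
    exact isCardinalPresentable_of_isColimit _ (colimit.isColimit (N ⋙ pZ.diag)) κ hℕ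
  · simp [g', reassoc_of% h']
  · refine colimit.hom_ext fun n ↦ ?_
    simp [g', hβ]
  · simp
  · simp

namespace factorsThroughPresentables

instance isStableUnderCobaseChange [IsCardinalLocallyPresentable C κ] (T : MorphismProperty C)
    [T.IsStableUnderCobaseChange] :
    (factorsThroughPresentables κ T).IsStableUnderCobaseChange where
  of_isPushout {X Z Y W g f g' f'} sq hg := by
    intro K L i u v hK hL h₀
    obtain ⟨D, _, _, pX, pY, pZ, α, β, hα, hβ, hX, hY, hZ⟩ :=
      exists_span_presentation (κ := κ) f g
    have (d d' : D) (φ : d ⟶ d') :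
        ∃ m : pushout (α.app d) (β.app d) ⟶ pushout (α.app d') (β.app d'),
          pushout.inl _ _ ≫ m = pY.diag.map φ ≫ pushout.inl _ _ ∧
          pushout.inr _ _ ≫ m = pZ.diag.map φ ≫ pushout.inr _ _ :=
      ⟨pushout.desc _ _ (by rw [← α.naturality_assoc, pushout.condition, β.naturality_assoc]),
        pushout.inl_desc _ _ _, pushout.inr_desc _ _ _⟩
    choose m hm₁ hm₂ using this
    let Q : D ⥤ C :=
      { obj d := pushout (α.app d) (β.app d)
        map {d d'} φ := m d d' φ
        map_id d := pushout.hom_ext (by simp [hm₁]) (by simp [hm₂])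
        map_comp φ ψ := pushout.hom_ext (by rw [reassoc_of% hm₁, hm₁, hm₁]; simp)
          (by rw [reassoc_of% hm₂, hm₂, hm₂]; simp) }
    let ιY : pY.diag ⟶ Q := { app d := pushout.inl _ _, naturality _ _ _ := (hm₁ _ _ _).symm }
    let ιZ : pZ.diag ⟶ Q := { app d := pushout.inr _ _, naturality _ _ _ := (hm₂ _ _ _).symm }
    have hQ (d : D) {V : C} {k l : Q.obj d ⟶ V} (h₁ : ιY.app d ≫ k = ιY.app d ≫ l)
        (h₂ : ιZ.app d ≫ k = ιZ.app d ≫ l) : k = l := pushout.hom_ext h₁ h₂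
    have (d : D) : ∃ k : Q.obj d ⟶ W, ιY.app d ≫ k = pY.ι.app d ≫ g' ∧
        ιZ.app d ≫ k = pZ.ι.app d ≫ f' :=
      ⟨pushout.desc (pY.ι.app d ≫ g') (pZ.ι.app d ≫ f') (by
        rw [← reassoc_of% hα, sq.w, reassoc_of% hβ]),
        pushout.inl_desc _ _ _, pushout.inr_desc _ _ _⟩
    choose k hk₁ hk₂ using this
    let c : Cocone Q := Cocone.mk W
      { app d := k d
        naturality d d' φ := hQ d
          (by rw [← ιY.naturality_assoc, hk₁]; simp [hk₁])
          (by rw [← ιZ.naturality_assoc, hk₂]; simp [hk₂]) }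
    have hιQ (d : D) : α.app d ≫ ιY.app d = β.app d ≫ ιZ.app d := pushout.condition
    have hY' (s : Cocone Q) (d : D) : pY.ι.app d ≫ pY.isColimit.desc (Cocone.mk _ (ιY ≫ s.ι)) =
        ιY.app d ≫ s.ι.app d := pY.isColimit.fac (Cocone.mk _ (ιY ≫ s.ι)) d
    have hZ' (s : Cocone Q) (d : D) : pZ.ι.app d ≫ pZ.isColimit.desc (Cocone.mk _ (ιZ ≫ s.ι)) =
        ιZ.app d ≫ s.ι.app d := pZ.isColimit.fac (Cocone.mk _ (ιZ ≫ s.ι)) d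
    let hc : IsColimit c :=
      { desc s := sq.desc (pY.isColimit.desc (Cocone.mk _ (ιY ≫ s.ι)))
          (pZ.isColimit.desc (Cocone.mk _ (ιZ ≫ s.ι))) (pX.isColimit.hom_ext fun d ↦ by
            erw [reassoc_of% hα, reassoc_of% hβ, hY', hZ', reassoc_of% hιQ])
        fac s d := hQ d
          (by rw [reassoc_of% hk₁, sq.inl_desc, hY']) (by rw [reassoc_of% hk₂, sq.inr_desc, hZ'])
        uniq s m hm := sq.hom_ext
          (pY.isColimit.hom_ext fun d ↦ by
            erw [sq.inl_desc, hY', ← reassoc_of% hk₁, hm])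
          (pZ.isColimit.hom_ext fun d ↦ by
            erw [sq.inr_desc, hZ', ← reassoc_of% hk₂, hm]) }
    obtain ⟨d, u, v, h, rfl, rfl⟩ := exists_fac_of_isColimit (κ := κ) ιY pY.isColimit hc
      (g := g') (fun d ↦ (hk₁ d).symm) i u v h₀
    obtain ⟨X', Z', a, b, j, s, t, hX', hZ', hj, h₁, h₂, h₃, h₄⟩ :=
      hg (β.app d) (pX.ι.app d) (pZ.ι.app d) (hX d) (hZ d) (hβ d)
    let b' : Q.obj d ⟶ pushout (pushout.inr (α.app d) a) j :=
      pushout.desc (pushout.inl _ _ ≫ pushout.inl _ _) (b ≫ pushout.inr _ _) (by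
        rw [pushout.condition_assoc, pushout.condition, reassoc_of% h₁])
    have hb' : ιY.app d ≫ b' = pushout.inl _ _ ≫ pushout.inl _ _ := pushout.inl_desc _ _ _
    let s' : pushout (α.app d) a ⟶ Y := pushout.desc (pY.ι.app d) (s ≫ f) (by
      rw [← hα, reassoc_of% h₃])
    have hs' : pushout.inr _ _ ≫ s' = s ≫ f := pushout.inr_desc _ _ _
    have hs'' : pushout.inl _ _ ≫ s' = pY.ι.app d := pushout.inl_desc _ _ _
    have hK' := isCardinalPresentable_pushout (α.app d) a (hX d) (hY d) hX'
    refine ⟨pushout (α.app d) a, pushout (pushout.inr (α.app d) a) j, u ≫ pushout.inl _ _,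
      v ≫ b', pushout.inl _ _, s', pushout.desc (s' ≫ g') (t ≫ f') (by
        rw [reassoc_of% hs', sq.w, reassoc_of% h₂]), hK',
      isCardinalPresentable_pushout _ _ hX' hK' hZ', T.pushout_inl _ _ hj, ?_, ?_, ?_, ?_⟩
    · rw [Category.assoc, ← hb', reassoc_of% h]
    · rw [pushout.inl_desc]
    · rw [Category.assoc, hs'']
    · rw [Category.assoc]
      congr 1
      refine hQ d ?_ ?_
      · rw [reassoc_of% hb', pushout.inl_desc, reassoc_of% hs'', hk₁]
      · erw [pushout.inr_desc_assoc]
        rw [Category.assoc, pushout.inr_desc, reassoc_of% h₄, hk₂]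

lemma of_isCardinalPresentable {T : MorphismProperty C} {X Y : C} {g : X ⟶ Y}
    (hX : IsCardinalPresentable X κ) (hY : IsCardinalPresentable Y κ) (hg : T g) :
    factorsThroughPresentables κ T g :=
  fun _ _ _ u v _ _ h ↦ ⟨X, Y, u, v, g, 𝟙 X, 𝟙 Y, hX, hY, hg, h, by simp, by simp, by simp⟩

end factorsThroughPresentables

/-- The cocone exhibiting a coproduct as the filtered colimit of the coproducts over the finite
subsets of the index type. -/
@[simps]
noncomputable def liftToFinsetCocone [HasFiniteCoproducts C] {S : Type v} {F : Discrete S ⥤ C}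
    (c : Cocone F) : Cocone (CoproductsFromFiniteFiltered.liftToFinsetObj F) where
  pt := c.pt
  ι :=
    { app s := Sigma.desc fun x ↦ c.ι.app x
      naturality s t φ := Sigma.hom_ext _ _ fun x ↦ by
        erw [Sigma.ι_desc_assoc, Sigma.ι_desc, Sigma.ι_desc_assoc, Category.comp_id] }

/-- The cocone `liftToFinsetCocone c` is colimit if `c` is. -/
noncomputable def isColimitLiftToFinsetCocone [HasFiniteCoproducts C] {S : Type v}
    {F : Discrete S ⥤ C} {c : Cocone F} (hc : IsColimit c) :
    IsColimit (liftToFinsetCocone c) where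
  desc t := hc.desc (Cocone.mk t.pt (Discrete.natTrans fun j ↦
    Sigma.ι (fun x : ({j} : Finset (Discrete S)) ↦ F.obj x) ⟨j, by simp⟩ ≫ t.ι.app {j}))
  fac t s := Sigma.hom_ext _ _ fun x ↦ by
    have h : Sigma.ι (fun y : ({x.1} : Finset (Discrete S)) ↦ F.obj y) ⟨x.1, by simp⟩ ≫
        t.ι.app {x.1} = Sigma.ι (fun y : s ↦ F.obj y) x ≫ t.ι.app s := by
      rw [← t.w (homOfLE (Finset.singleton_subset_iff.2 x.2))]
      erw [Sigma.ι_desc_assoc]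
      rfl
    erw [Sigma.ι_desc_assoc, hc.fac]
    exact h
  uniq t m hm := hc.hom_ext fun j ↦ by
    rw [hc.fac]
    dsimp only [Discrete.natTrans_app]
    rw [← hm]
    erw [Sigma.ι_desc_assoc]
    rfl

lemma isCardinalPresentable_sigma [HasFiniteCoproducts C] {I : Type v} [Finite I] (X : I → C)
    (hX : ∀ i, IsCardinalPresentable (X i) κ) : IsCardinalPresentable (∐ X) κ := by
  have (i : Discrete I) : IsCardinalPresentable ((Discrete.functor X).obj i) κ := hX _
  refine isCardinalPresentable_of_isColimit _ (colimit.isColimit (Discrete.functor X)) κ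
    (.of_le ?_ (Cardinal.IsRegular.aleph0_le (c := κ) Fact.out))
  rw [hasCardinalLT_aleph0_iff]
  infer_instance

lemma coproducts_le_factorsThroughPresentables [HasColimits C]
    [Fact (Cardinal.IsRegular Cardinal.aleph0.{v})] {T : MorphismProperty C}
    [MorphismProperty.IsStableUnderCoproducts.{v} T] (hJT : J ≤ T)
    (hJ : ∀ ⦃A B : C⦄ (j : A ⟶ B), J j → IsCardinalPresentable A Cardinal.aleph0.{v} ∧
      IsCardinalPresentable B Cardinal.aleph0.{v}) :
    MorphismProperty.coproducts.{v} J ≤ factorsThroughPresentables Cardinal.aleph0 T := by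
  intro X Y f hf
  rw [MorphismProperty.coproducts_iff] at hf
  obtain ⟨S, ⟨F, G, c, d, hc, hd, φ, hφ⟩⟩ := hf
  classical
  have : IsCardinalFiltered (Finset (Discrete S)) Cardinal.aleph0.{v} :=
    (isCardinalFiltered_aleph0_iff.{v} _).2 inferInstance
  refine (factorsThroughPresentables.isStableUnderColimitsOfShape T _).condition _ _ _ _
    (isColimitLiftToFinsetCocone hc) (isColimitLiftToFinsetCocone hd)
    ((CoproductsFromFiniteFiltered.liftToFinset C S).map φ) (fun s ↦ ?_) _ (fun s ↦ ?_)
  · refine factorsThroughPresentables.of_isCardinalPresentable ?_ ?_ ?_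
    · exact isCardinalPresentable_sigma _ fun x ↦ (hJ _ (hφ x)).1
    · exact isCardinalPresentable_sigma _ fun x ↦ (hJ _ (hφ x)).2
    · exact T.colimMap _ fun x ↦ hJT _ (hφ x.as)
  · refine Sigma.hom_ext _ _ fun x ↦ ?_
    have h : Sigma.ι (fun y : s ↦ F.obj y) x ≫
        ((CoproductsFromFiniteFiltered.liftToFinset C S).map φ).app s ≫
          (liftToFinsetCocone d).ι.app s = φ.app x ≫ d.ι.app x :=
      (Sigma.ι_map_assoc (fun y : s ↦ φ.app y) x _).trans
        (congrArg (φ.app x ≫ ·) (Sigma.ι_desc _ _))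
    erw [Sigma.ι_desc_assoc, hc.fac]
    exact h.symm

lemma rlp_llp_le_factorsThroughPresentables_aleph0
    [Fact (Cardinal.IsRegular Cardinal.aleph0.{v})]
    [IsCardinalLocallyPresentable C Cardinal.aleph0.{v}] [MorphismProperty.IsSmall.{v} J]
    (hJ : ∀ ⦃A B : C⦄ (j : A ⟶ B), J j → IsCardinalPresentable A Cardinal.aleph0.{v} ∧
      IsCardinalPresentable B Cardinal.aleph0.{v}) :
    J.rlp.llp ≤ factorsThroughPresentables Cardinal.aleph0 J.rlp.llp := by
  let := Cardinal.orderBotAleph0OrdToType.{v}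
  have := isCardinalForSmallObjectArgument (κ := .aleph0) (J := J) (fun _ _ j hj ↦ (hJ j hj).1)
  have : (factorsThroughPresentables Cardinal.aleph0 J.rlp.llp).IsMultiplicative := { }
  have : (factorsThroughPresentables Cardinal.aleph0
      J.rlp.llp).IsStableUnderTransfiniteCompositionOfShape ℕ :=
    .of_isStableUnderColimitsOfShape fun D _ _ _ _ ↦ by
      have := (isCardinalFiltered_aleph0_iff.{v} D).2 inferInstance
      infer_instance
  conv_lhs => rw [SmallObject.llp_rlp_of_isCardinalForSmallObjectArgument_aleph0]
  rw [MorphismProperty.retracts_le_iff]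
  refine le_trans ?_ (MorphismProperty.transfiniteCompositionsOfShape_le _ ℕ)
  refine MorphismProperty.transfiniteCompositionsOfShape_monotone _ ?_
  rw [MorphismProperty.pushouts_le_iff]
  exact coproducts_le_factorsThroughPresentables J.le_llp_rlp hJ

end CombinatorialModel

namespace PaperAcc

section

variable {M : Type u} [Category.{v} M] {κ : Cardinal.{v}}

lemma isCardinalFiltered_iff [Fact κ.IsRegular] (J : Type v) [SmallCategory J] :
    IsCardinalFiltered J κ ↔ CategoryTheory.IsCardinalFiltered J κ :=
  ⟨fun h ↦ ⟨fun F hA ↦ h _ ((hasCardinalLT_iff_cardinal_mk_lt _ _).1 hA) F⟩,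
    fun h _ _ hA F ↦ h.nonempty_cocone F ((hasCardinalLT_iff_cardinal_mk_lt _ _).2 hA)⟩

lemma isPresentable_iff [Fact κ.IsRegular] (X : M) :
    IsPresentable κ X ↔ IsCardinalPresentable X κ :=
  ⟨fun h ↦ ⟨fun J _ hJ ↦ (h J ((isCardinalFiltered_iff J).2 hJ)).some⟩,
    fun h J _ hJ ↦ by
      have := (isCardinalFiltered_iff J).1 hJ
      exact ⟨h.preservesColimitOfShape J⟩⟩

lemma IsLocallyPresentable.isCardinalLocallyPresentable [Fact κ.IsRegular]
    (h : IsLocallyPresentable M κ) : IsCardinalLocallyPresentable M κ := by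
  obtain ⟨_, ι, G, hG, hX⟩ := h
  have : HasCardinalFilteredGenerator M κ :=
    { exists_generator := by
        refine ⟨ObjectProperty.ofObj G, inferInstance, ?_, fun X ↦ ?_⟩
        · rintro _ ⟨i⟩
          exact (isPresentable_iff _).1 (hG i)
        · obtain ⟨J, hJ, F, hF, c, hc, e⟩ := hX X
          refine ⟨J, inferInstance, (isCardinalFiltered_iff J).1 hJ,
            ObjectProperty.prop_of_iso _ e ⟨⟨⟨F, c.ι, hc⟩, fun j ↦ ?_⟩⟩⟩
          obtain ⟨i, hi⟩ := hF j
          exact (ObjectProperty.ofObj_iff _ _).2 ⟨i, hi⟩ }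
  constructor

lemma llp_rlpOf {ι : Type v} {A B : ι → M} (f : ∀ i, A i ⟶ B i) :
    Llp (RlpOf f) = (MorphismProperty.ofHoms f).rlp.llp := by
  have h : RlpOf f = (MorphismProperty.ofHoms f).rlp := by
    ext X Y g
    exact ⟨fun hg _ _ _ ⟨i⟩ ↦ hg i, fun hg i ↦ hg _ ⟨i⟩⟩
  rw [← h]
  rfl

/-- In a `κ`-combinatorial model category, every square from a morphism between `κ`-presentable
objects to a trivial cofibration factors through a trivial cofibration between `κ`-presentable
objects. -/
lemma IsCombinatorial.trivCof_le_factorsThroughPresentables [Fact κ.IsRegular]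
    {S : ModelStructure M} (hS : IsCombinatorial S κ) :
    S.Cof ⊓ S.W ≤ CombinatorialModel.factorsThroughPresentables κ (S.Cof ⊓ S.W) := by
  have := hS.locallyPresentable.isCardinalLocallyPresentable
  obtain ⟨ι, A, B, f, hA, hB, h⟩ := hS.trivCofGenerated
  rw [h, llp_rlpOf]
  have hJ ⦃X Y : M⦄ (j : X ⟶ Y) (hj : MorphismProperty.ofHoms f j) :
      IsCardinalPresentable X κ ∧ IsCardinalPresentable Y κ := by
    obtain ⟨i⟩ := hj
    exact ⟨(isPresentable_iff _).1 (hA i), (isPresentable_iff _).1 (hB i)⟩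
  obtain rfl | hκ := hS.isRegular.aleph0_le.eq_or_lt
  · exact CombinatorialModel.rlp_llp_le_factorsThroughPresentables_aleph0 hJ
  · exact CombinatorialModel.rlp_llp_le_factorsThroughPresentables_of_aleph0_lt hκ hJ

end

/-- Corollary 3.5. Let `M` be a `κ`-combinatorial model category and consider
a commutative square with top `u : K ⟶ X`, left `i : K ⟶ L`, right `f : X ⟶ Y` and bottom
`v : L ⟶ Y`, where `i` is a cofibration between `κ`-presentable objects and `f` is a weak
equivalence. Then the square factors, as a horizontal composite of two commutative squares,
through a trivial cofibration `j : K' ⟶ L'` between `κ`-presentable objects. -/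
theorem statement3 {M : Type u} [Category.{v} M] (κ : Cardinal.{v})
    (S : ModelStructure M) (hcomb : IsCombinatorial S κ)
    {K L X Y : M} (u : K ⟶ X) (i : K ⟶ L) (f : X ⟶ Y) (v : L ⟶ Y)
    (hsq : u ≫ f = i ≫ v) (hi : S.Cof i)
    (hK : IsPresentable κ K) (hL : IsPresentable κ L) (hf : S.W f) :
    ∃ (K' L' : M) (a : K ⟶ K') (b : L ⟶ L') (j : K' ⟶ L') (u' : K' ⟶ X) (v' : L' ⟶ Y),
      IsPresentable κ K' ∧ IsPresentable κ L' ∧ S.Cof j ∧ S.W j ∧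
      a ≫ j = i ≫ b ∧ u' ≫ f = j ≫ v' ∧ a ≫ u' = u ∧ b ≫ v' = v := by
  have : Fact κ.IsRegular := ⟨hcomb.isRegular⟩
  obtain ⟨Z, k, p, hk, hk', hp, rfl⟩ := S.fact_trivCof_fib f
  have := S.lift_cof_trivFib i p hi hp (S.W_of_comp_left k p hk' hf)
  have sq : CommSq (u ≫ k) i p v := ⟨by rw [Category.assoc, hsq]⟩
  obtain ⟨K', L', a, b, j, u', v', hK', hL', hj, h₁, h₂, h₃, h₄⟩ :=
    hcomb.trivCof_le_factorsThroughPresentables k ⟨hk, hk'⟩ i u sq.lift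
      ((isPresentable_iff K).1 hK) ((isPresentable_iff L).1 hL) sq.fac_left.symm
  exact ⟨K', L', a, b, j, u', v' ≫ p, (isPresentable_iff K').2 hK', (isPresentable_iff L').2 hL',
    hj.1, hj.2, h₁, by rw [reassoc_of% h₂], h₃, by rw [reassoc_of% h₄, sq.fac_right]⟩

end PaperAcc
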